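/- Elementary Tree Cost Lemma: if a set of elements is inserted one by one into an elementary tree of height h whose root is labeled by an interval of length ℓ (each insertion succeeding), then the sum of |x − y| over all pairs x, y of elements occupying consecutive non-empty cells of the tree's array is at most ℓ·h. -/

import Mathlib

/-!
STATEMENT 9 (Elementary Tree Cost Lemma): if a set of elements is inserted one by one into
an elementary tree of height `h` whose root is labeled by an interval of length `ℓ`, with
every insertion succeeding, then the sum of `|x - y|` over pairs of elements in consecutive
non-empty cells of the tree's array (leaves read left to right) is at most `ℓ · h`.
-/

noncomputable section
attribute [local instance] Classical.propDecidable

/-- The state of an elementary tree: nodes are identified with paths from the root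
(`false` = left, `true` = right); `label` records the interval `[lo, hi)` labeling a
marked node (`none` = unmarked), and `occ` records the element written in a leaf cell. -/
structure ETState where
  label : List Bool → Option (ℝ × ℝ)
  occ : List Bool → Option ℝ

/-- The initial state of an elementary tree whose root is statically labeled `I`. -/
def ETState.init (I : ℝ × ℝ) : ETState :=
  ⟨fun p => if p = [] then some I else none, fun _ => none⟩

/-- The half of the interval `I = [lo, hi)` containing `x`. -/
def halfContaining (I : ℝ × ℝ) (x : ℝ) : ℝ × ℝ :=
  if x < (I.1 + I.2) / 2 then (I.1, (I.1 + I.2) / 2) else ((I.1 + I.2) / 2, I.2)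

def ETState.setLabel (s : ETState) (p : List Bool) (I : ℝ × ℝ) : ETState :=
  ⟨fun q => if q = p then some I else s.label q, s.occ⟩

def ETState.setOcc (s : ETState) (p : List Bool) (x : ℝ) : ETState :=
  ⟨s.label, fun q => if q = p then some x else s.occ q⟩

/-- `etInsert d p pl x s` is the recursive procedure `insert(v, x)` at the node `v` with
path `p` and height `d` above the leaves (so leaves have `d = 0`), where `pl` is the label
of `v`'s parent.  It returns the success flag together with the updated state:
* an unmarked leaf gets labeled with the half of `pl` containing `x`, and `x` is written
  into its cell (success); a marked leaf yields failure;
* a marked internal node: failure if `x` is inadmissible, otherwise insert into the left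
  child and, if that fails, into the right child;
* an unmarked internal node gets labeled with the half of `pl` containing `x`, and the
  insertion proceeds into its left child. -/
def etInsert : ℕ → List Bool → (ℝ × ℝ) → ℝ → ETState → Bool × ETState
  | 0, p, pl, x, s =>
    match s.label p with
    | none => (true, (s.setLabel p (halfContaining pl x)).setOcc p x)
    | some _ => (false, s)
  | d + 1, p, pl, x, s =>
    match s.label p with
    | none =>
        let I := halfContaining pl x
        etInsert d (p ++ [false]) I x (s.setLabel p I)
    | some I =>
        if I.1 ≤ x ∧ x < I.2 then
          match etInsert d (p ++ [false]) I x s with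
          | (true, s') => (true, s')
          | (false, s') => etInsert d (p ++ [true]) I x s'
        else (false, s)

/-- Insert `x` at the root of an elementary tree of height `h` (the root is always
marked, so the parent label passed along is irrelevant). -/
def etInsertTop (h : ℕ) (x : ℝ) (s : ETState) : Bool × ETState :=
  etInsert h [] ((s.label []).getD (0, 1)) x s

/-- Insert the elements of `xs` one by one into an elementary tree of height `h` with
root label `I`, returning the conjunction of all success flags and the final state. -/
def etRunAll (h : ℕ) (I : ℝ × ℝ) (xs : List ℝ) : Bool × ETState :=
  xs.foldl (fun acc x =>
    let r := etInsertTop h x acc.2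
    (acc.1 && r.1, r.2)) (true, ETState.init I)

/-- The path (of length `h`) of the `i`-th leaf from the left in a tree of height `h`. -/
def pathOfIdx (h i : ℕ) : List Bool :=
  (List.range h).map fun k => Nat.testBit i (h - 1 - k)

/-- Cost of a configuration `g` of optional values in cells `0, …, N-1`: the sum of
`|x - y|` over all pairs of values occupying consecutive non-empty cells. -/
def configCost {N : ℕ} (g : Fin N → Option ℝ) : ℝ :=
  ∑ i : Fin N, ∑ j : Fin N,
    if (g i).isSome = true ∧ (g j).isSome = true ∧ i < j ∧
        (∀ k : Fin N, i < k → k < j → g k = none) then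
      |(g i).getD 0 - (g j).getD 0|
    else 0

structure ETInv (s : ETState) : Prop where
  A : ∀ p b J, s.label (p ++ [b]) = some J → ∃ I : ℝ × ℝ, s.label p = some I ∧
    (J = (I.1, (I.1 + I.2) / 2) ∨ J = ((I.1 + I.2) / 2, I.2))
  B : ∀ p x, s.occ p = some x → ∃ I : ℝ × ℝ, s.label p = some I ∧ I.1 ≤ x ∧ x ≤ I.2
  C : ∀ p I, s.label p = some I → I.1 ≤ I.2

def ETExt (s t : ETState) : Prop := ∀ q I, s.label q = some I → t.label q = some I

theorem half_cases (I : ℝ × ℝ) (x : ℝ) (h1 : I.1 ≤ x) (h2 : x ≤ I.2) :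
    (halfContaining I x = (I.1, (I.1 + I.2) / 2) ∨
      halfContaining I x = ((I.1 + I.2) / 2, I.2)) ∧
    (halfContaining I x).1 ≤ x ∧ x ≤ (halfContaining I x).2 := by
  unfold halfContaining
  split_ifs with h
  · exact ⟨Or.inl rfl, h1, h.le⟩
  · exact ⟨Or.inr rfl, not_lt.1 h, h2⟩

theorem setLabel_inv (s : ETState) (hs : ETInv s) (q : List Bool) (b : Bool) (pl : ℝ × ℝ) (x : ℝ)
    (hq : s.label q = some pl) (h1 : pl.1 ≤ x) (h2 : x ≤ pl.2)
    (hp : s.label (q ++ [b]) = none) :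
    ETInv (s.setLabel (q ++ [b]) (halfContaining pl x)) ∧
    ETExt s (s.setLabel (q ++ [b]) (halfContaining pl x)) := by
  obtain ⟨hc, h3, h4⟩ := half_cases pl x h1 h2
  have ext : ETExt s (s.setLabel (q ++ [b]) (halfContaining pl x)) := by
    intro r I hr
    have : r ≠ q ++ [b] := by rintro rfl; simp [hp] at hr
    simp [ETState.setLabel, this, hr]
  refine ⟨⟨?_, ?_, ?_⟩, ext⟩
  · intro p c J hJ
    by_cases hpc : p ++ [c] = q ++ [b]
    · obtain ⟨rfl, -⟩ := List.append_inj' hpc rfl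
      simp only [ETState.setLabel, hpc, if_true, Option.some.injEq] at hJ
      exact ⟨pl, ext _ _ hq, hJ ▸ hc⟩
    · simp only [ETState.setLabel, hpc, if_false] at hJ
      obtain ⟨I, hI, h⟩ := hs.A p c J hJ
      exact ⟨I, ext _ _ hI, h⟩
  · intro p y hy
    obtain ⟨I, hI, h⟩ := hs.B p y hy
    exact ⟨I, ext _ _ hI, h⟩
  · intro p I hI
    by_cases hpc : p = q ++ [b]
    · simp only [ETState.setLabel, hpc, if_true, Option.some.injEq] at hI
      subst hI; linarith
    · simp only [ETState.setLabel, hpc, if_false] at hI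
      exact hs.C p I hI

theorem etInsert_inv (d : ℕ) : ∀ (p : List Bool) (pl : ℝ × ℝ) (x : ℝ) (s : ETState), ETInv s →
    ((∃ I, s.label p = some I) ∨
      (∃ q b, p = q ++ [b] ∧ s.label q = some pl ∧ pl.1 ≤ x ∧ x ≤ pl.2)) →
    ETInv (etInsert d p pl x s).2 ∧ ETExt s (etInsert d p pl x s).2 := by
  induction d with
  | zero =>
    intro p pl x s hs h
    unfold etInsert
    cases hl : s.label p with
    | some I => exact ⟨hs, fun _ _ h => h⟩
    | none =>
      simp only [hl, reduceCtorEq, exists_false, false_or] at h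
      obtain ⟨q, b, rfl, hq, h1, h2⟩ := h
      obtain ⟨i, e⟩ := setLabel_inv s hs q b pl x hq h1 h2 hl
      obtain ⟨-, h3, h4⟩ := half_cases pl x h1 h2
      refine ⟨⟨i.A, ?_, i.C⟩, e⟩
      intro p y hy
      by_cases hpc : p = q ++ [b]
      · simp only [ETState.setOcc, hpc, if_true, Option.some.injEq] at hy
        subst hy
        exact ⟨halfContaining pl x, by simp [ETState.setOcc, ETState.setLabel, hpc], h3, h4⟩
      · simp only [ETState.setOcc, hpc, if_false] at hy
        exact i.B p y hy
  | succ d ih =>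
    intro p pl x s hs h
    unfold etInsert
    cases hl : s.label p with
    | none =>
      simp only [hl, reduceCtorEq, exists_false, false_or] at h
      obtain ⟨q, b, rfl, hq, h1, h2⟩ := h
      obtain ⟨i, e⟩ := setLabel_inv s hs q b pl x hq h1 h2 hl
      obtain ⟨-, h3, h4⟩ := half_cases pl x h1 h2
      obtain ⟨i', e'⟩ := ih (q ++ [b] ++ [false]) (halfContaining pl x) x _ i
        (Or.inr ⟨_, _, rfl, by simp [ETState.setLabel], h3, h4⟩)
      exact ⟨i', fun _ _ h => e' _ _ (e _ _ h)⟩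
    | some I =>
      dsimp only
      split_ifs with hx
      · obtain ⟨i, e⟩ := ih (p ++ [false]) I x s hs (Or.inr ⟨_, _, rfl, hl, hx.1, hx.2.le⟩)
        split
        · rename_i s' heq
          rw [heq] at i e
          exact ⟨i, e⟩
        · rename_i s' heq
          rw [heq] at i e
          obtain ⟨i', e'⟩ := ih (p ++ [true]) I x s' i
            (Or.inr ⟨_, _, rfl, e _ _ hl, hx.1, hx.2.le⟩)
          exact ⟨i', fun _ _ h => e' _ _ (e _ _ h)⟩
      · exact ⟨hs, fun _ _ h => h⟩

theorem run_inv (h : ℕ) (I : ℝ × ℝ) (xs : List ℝ) : ∀ acc : Bool × ETState,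
    ETInv acc.2 → acc.2.label [] = some I →
    ETInv (xs.foldl (fun acc x =>
      let r := etInsertTop h x acc.2
      (acc.1 && r.1, r.2)) acc).2 ∧
    (xs.foldl (fun acc x =>
      let r := etInsertTop h x acc.2
      (acc.1 && r.1, r.2)) acc).2.label [] = some I := by
  induction xs with
  | nil => intro acc h1 h2; exact ⟨h1, h2⟩
  | cons x xs ih =>
    intro acc h1 h2
    obtain ⟨i, e⟩ := etInsert_inv h [] ((acc.2.label []).getD (0, 1)) x acc.2 h1 (Or.inl ⟨_, h2⟩)
    exact ih _ i (e _ _ h2)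

theorem label_anc (s : ETState) (hs : ETInv s) (p q : List Bool) : ∀ J,
    s.label (p ++ q) = some J → ∃ I : ℝ × ℝ, s.label p = some I ∧ I.1 ≤ J.1 ∧ J.2 ≤ I.2 := by
  induction q using List.reverseRecOn with
  | nil => intro J h; exact ⟨J, by simpa using h, le_rfl, le_rfl⟩
  | append_singleton q b ih =>
    intro J h
    rw [← List.append_assoc] at h
    obtain ⟨K, hK, hJ⟩ := hs.A _ _ _ h
    obtain ⟨I, hI, h1, h2⟩ := ih K hK
    have := hs.C _ _ hK
    refine ⟨I, hI, ?_⟩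
    rcases hJ with rfl | rfl <;> constructor <;> dsimp only <;> linarith

theorem occ_anc (s : ETState) (hs : ETInv s) (p q : List Bool) (x : ℝ)
    (h : s.occ (p ++ q) = some x) : ∃ I : ℝ × ℝ, s.label p = some I ∧ I.1 ≤ x ∧ x ≤ I.2 := by
  obtain ⟨J, hJ, h1, h2⟩ := hs.B _ _ h
  obtain ⟨I, hI, h3, h4⟩ := label_anc s hs p q J hJ
  exact ⟨I, hI, by linarith, by linarith⟩

theorem sum_le_of_unique {ι : Type*} (S : Finset ι) (f : ι → ℝ) (D : ℝ) (hD : 0 ≤ D)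
    (hf : ∀ i ∈ S, f i ≤ D)
    (hu : ∀ i ∈ S, ∀ j ∈ S, f i ≠ 0 → f j ≠ 0 → i = j) : ∑ i ∈ S, f i ≤ D := by
  by_cases h : ∃ i ∈ S, f i ≠ 0
  · obtain ⟨i, hi, hne⟩ := h
    rw [Finset.sum_eq_single_of_mem i hi]
    · exact hf i hi
    · intro j hj hji
      by_contra hc
      exact hji (hu j hj i hi hc hne)
  · push Not at h
    rw [Finset.sum_eq_zero h]; exact hD

theorem configCost_add (m n : ℕ) (f : ℕ → Option ℝ) (D : ℝ) (hD : 0 ≤ D)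
    (hf : ∀ i j x y, i < m → j < n → f i = some x → f (m + j) = some y → |x - y| ≤ D) :
    configCost (fun i : Fin (m + n) => f i) ≤
      configCost (fun i : Fin m => f i) + configCost (fun i : Fin n => f (m + i)) + D := by
  unfold configCost
  rw [Fin.sum_univ_add]
  simp only [Fin.sum_univ_add (M := ℝ), Finset.sum_add_distrib]
  have e1 : ∀ i j : Fin m, (∀ k : Fin (m + n), Fin.castAdd n i < k → k < Fin.castAdd n j →
      f k = none) ↔ (∀ k : Fin m, i < k → k < j → f k = none) := by
    intro i j
    constructor
    · intro H k h1 h2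
      exact H (Fin.castAdd n k) h1 h2
    · intro H k h1 h2
      have h2' : (k : ℕ) < j := h2
      exact H ⟨k, by omega⟩ h1 h2
  have e2 : ∀ i j : Fin n, (∀ k : Fin (m + n), Fin.natAdd m i < k → k < Fin.natAdd m j →
      f k = none) ↔ (∀ k : Fin n, i < k → k < j → f (m + k) = none) := by
    intro i j
    constructor
    · intro H k h1 h2
      exact H (Fin.natAdd m k) (by simpa using h1) (by simpa using h2)
    · intro H k h1 h2
      have h1' : m + (i : ℕ) < k := h1
      have h2' : (k : ℕ) < m + j := h2
      have := H ⟨k - m, by omega⟩ (show (i : ℕ) < k - m by omega) (show k - m < (j : ℕ) by omega)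
      simpa [show m + ((k : ℕ) - m) = k by omega] using this
  have e3 : ∀ (i : Fin n) (j : Fin m), ¬ (Fin.natAdd m i < Fin.castAdd n j) := by
    intro i j h
    have h' : m + (i : ℕ) < j := h
    omega
  have c1 : ∀ i j : Fin m, (Fin.castAdd n i < Fin.castAdd n j) ↔ i < j := fun i j => Iff.rfl
  have c2 : ∀ i j : Fin n, (Fin.natAdd m i < Fin.natAdd m j) ↔ i < j := by
    intro i j; simp
  have cross : ∑ i : Fin m, ∑ j : Fin n,
      (if (f (Fin.castAdd n i)).isSome = true ∧ (f (Fin.natAdd m j)).isSome = true ∧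
        Fin.castAdd n i < Fin.natAdd m j ∧
        (∀ k : Fin (m + n), Fin.castAdd n i < k → k < Fin.natAdd m j → f k = none) then
      |(f (Fin.castAdd n i)).getD 0 - (f (Fin.natAdd m j)).getD 0| else 0) ≤ D := by
    rw [← Finset.sum_product']
    apply sum_le_of_unique _ _ _ hD
    · rintro ⟨i, j⟩ -
      dsimp only
      split_ifs with h
      · obtain ⟨x, hx⟩ := Option.isSome_iff_exists.1 h.1
        obtain ⟨y, hy⟩ := Option.isSome_iff_exists.1 h.2.1
        rw [hx, hy]
        exact hf i j x y i.2 j.2 hx hy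
      · exact hD
    · rintro ⟨i, j⟩ - ⟨i', j'⟩ - h1 h2
      have g1 := (ite_ne_right_iff.1 h1).1
      have g2 := (ite_ne_right_iff.1 h2).1
      have key : ∀ (i i' : Fin m) (j : Fin n), (f (Fin.castAdd n i')).isSome = true →
          (∀ k : Fin (m + n), Fin.castAdd n i < k → k < Fin.natAdd m j → f k = none) →
          ¬ i < i' := by
        intro i i' j hs hk hlt
        have := hk (Fin.castAdd n i') hlt (show (i' : ℕ) < m + j by omega)
        rw [this] at hs
        simp at hs
      have key2 : ∀ (i : Fin m) (j j' : Fin n), (f (Fin.natAdd m j')).isSome = true →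
          (∀ k : Fin (m + n), Fin.castAdd n i < k → k < Fin.natAdd m j → f k = none) →
          ¬ j' < j := by
        intro i j j' hs hk hlt
        have := hk (Fin.natAdd m j') (show (i : ℕ) < m + j' by omega)
          (show m + (j' : ℕ) < m + j by omega)
        rw [this] at hs
        simp at hs
      have a1 := key i i' j g2.1 g1.2.2.2
      have a2 := key i' i j' g1.1 g2.2.2.2
      have a3 := key2 i j j' g2.2.1 g1.2.2.2
      have a4 := key2 i' j' j g1.2.1 g2.2.2.2
      rw [le_antisymm (not_lt.1 a2) (not_lt.1 a1), le_antisymm (not_lt.1 a3) (not_lt.1 a4)]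
  simp only [e1, e2, e3, c1, c2, false_and, and_false, if_false, Finset.sum_const_zero,
    Fin.val_castAdd, Fin.val_natAdd] at cross ⊢
  linarith

theorem path_left (d i : ℕ) (hi : i < 2 ^ d) :
    pathOfIdx (d + 1) i = false :: pathOfIdx d i := by
  unfold pathOfIdx
  rw [List.range_succ_eq_map, List.map_cons, List.map_map]
  congr 1
  · simpa using Nat.testBit_lt_two_pow hi
  · apply List.map_congr_left
    intro k hk
    simp only [Function.comp]
    congr 1; omega

theorem path_right (d i : ℕ) (hi : i < 2 ^ d) :
    pathOfIdx (d + 1) (2 ^ d + i) = true :: pathOfIdx d i := by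
  unfold pathOfIdx
  rw [List.range_succ_eq_map, List.map_cons, List.map_map]
  congr 1
  · have := Nat.testBit_lt_two_pow hi
    simp [Nat.testBit_two_pow_add_eq, this]
  · apply List.map_congr_left
    intro k hk
    have hk' := List.mem_range.1 hk
    simp only [Function.comp]
    rw [Nat.testBit_two_pow_add_gt (by omega)]
    congr 1; omega

theorem configCost_none (N : ℕ) : configCost (fun _ : Fin N => none) = 0 := by
  simp [configCost]

theorem cost_bound (s : ETState) (hs : ETInv s) (d : ℕ) : ∀ (p : List Bool) (I : ℝ × ℝ),
    s.label p = some I →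
    configCost (fun i : Fin (2 ^ d) => s.occ (p ++ pathOfIdx d i)) ≤ (I.2 - I.1) * d := by
  induction d with
  | zero =>
    intro p I hI
    unfold configCost
    rw [Finset.sum_eq_zero]
    · simp
    · intro i _
      apply Finset.sum_eq_zero
      intro j _
      rw [if_neg]
      rintro ⟨-, -, hij, -⟩
      have h1 : (i : ℕ) < j := hij
      have h2 : (j : ℕ) < 1 := j.2
      omega
  | succ d ih =>
    intro p I hI
    have hC := hs.C _ _ hI
    have child : ∀ b, configCost (fun i : Fin (2 ^ d) => s.occ (p ++ [b] ++ pathOfIdx d i)) ≤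
        (I.2 - I.1) / 2 * d := by
      intro b
      cases hl : s.label (p ++ [b]) with
      | none =>
        have : (fun i : Fin (2 ^ d) => s.occ (p ++ [b] ++ pathOfIdx d i)) = fun _ => none := by
          funext i
          by_contra hne
          obtain ⟨x, hx⟩ := Option.ne_none_iff_exists'.1 hne
          obtain ⟨J, hJ, -⟩ := occ_anc s hs _ _ _ hx
          simp [hl] at hJ
        rw [this, configCost_none]
        have : 0 ≤ I.2 - I.1 := by linarith
        positivity
      | some J =>
        have := ih _ J hl
        obtain ⟨I', hI', hJ⟩ := hs.A _ _ _ hl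
        rw [hI] at hI'
        obtain rfl := Option.some.inj hI'
        have e : J.2 - J.1 = (I.2 - I.1) / 2 := by
          rcases hJ with rfl | rfl <;> dsimp only <;> ring
        rwa [e] at this
    have key := configCost_add (2 ^ d) (2 ^ d) (fun i => s.occ (p ++ pathOfIdx (d + 1) i))
      (I.2 - I.1) (by linarith) (by
        intro i j x y _ _ hx hy
        obtain ⟨I1, h1, h2, h3⟩ := occ_anc s hs _ _ _ hx
        obtain ⟨I2, h4, h5, h6⟩ := occ_anc s hs _ _ _ hy
        rw [hI] at h1 h4
        obtain rfl := Option.some.inj h1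
        obtain rfl := Option.some.inj h4
        rw [abs_le]; constructor <;> linarith)
    rw [show 2 ^ d + 2 ^ d = 2 ^ (d + 1) by ring] at key
    have l : (fun i : Fin (2 ^ d) => s.occ (p ++ pathOfIdx (d + 1) i)) =
        (fun i : Fin (2 ^ d) => s.occ (p ++ [false] ++ pathOfIdx d i)) := by
      funext i
      rw [path_left d i i.2]; simp
    have r : (fun i : Fin (2 ^ d) => s.occ (p ++ pathOfIdx (d + 1) (2 ^ d + i))) =
        (fun i : Fin (2 ^ d) => s.occ (p ++ [true] ++ pathOfIdx d i)) := by
      funext i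
      rw [path_right d i i.2]; simp
    have k1 := child false
    have k2 := child true
    simp only [l, r] at key
    push_cast
    linarith

theorem statement9 (h : ℕ) (I₀ : ℝ × ℝ) (hI₀ : I₀.1 ≤ I₀.2)
    (xs : List ℝ) (hsucc : (etRunAll h I₀ xs).1 = true) :
    configCost (fun i : Fin (2 ^ h) => (etRunAll h I₀ xs).2.occ (pathOfIdx h i.1)) ≤
      (I₀.2 - I₀.1) * h := by
  obtain ⟨i, e⟩ := run_inv h I₀ xs (true, ETState.init I₀)
    (by
      refine ⟨?_, ?_, ?_⟩
      · intro p b J hJ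
        simp [ETState.init] at hJ
      · intro p x hx
        simp [ETState.init] at hx
      · intro p I hI
        simp only [ETState.init] at hI
        split_ifs at hI
        obtain rfl := Option.some.inj hI
        exact hI₀)
    (by simp [ETState.init])
  exact cost_bound _ i h [] I₀ e
end
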